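/- Let H be a complex Hilbert space and let A be a bounded, self-adjoint, injective operator on H. Let |A| denote the positive square root of A ∘ A, defined via the continuous functional calculus. Then there exists a bounded operator J on H with J = J* and J ∘ J = 1 (a symmetry) such that A = J ∘ |A| and J ∘ |A| = |A| ∘ J. -/

import Mathlib

open ContinuousLinearMap

section PolarDecomposition

variable {H : Type*} [NormedAddCommGroup H] [InnerProductSpace ℂ H]

/-- A self-adjoint injective operator has dense range. -/
theorem IsSelfAdjoint.denseRange_of_injective [CompleteSpace H] {P : H →L[ℂ] H}
    (hP : IsSelfAdjoint P) (hinj : Function.Injective P) : DenseRange P := by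
  have h : (LinearMap.range P.toLinearMap)ᗮ = ⊥ := by
    rw [ContinuousLinearMap.orthogonal_range, ← ContinuousLinearMap.star_eq_adjoint, hP.star_eq]
    exact LinearMap.ker_eq_bot.mpr hinj
  have hdense := Submodule.dense_iff_topologicalClosure_eq_top.mpr
    (Submodule.topologicalClosure_eq_top_iff.mpr h)
  rwa [LinearMap.coe_range] at hdense

/-- An operator with dense range can be cancelled on the right. -/
theorem ContinuousLinearMap.mul_right_cancel_of_denseRange {P X Y : H →L[ℂ] H}
    (hP : DenseRange P) (h : X * P = Y * P) : X = Y :=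
  DFunLike.coe_injective <| hP.equalizer X.continuous Y.continuous <|
    funext fun x => DFunLike.congr_fun h x

/-- Operators with the same modulus have the same pointwise norms. -/
theorem ContinuousLinearMap.norm_apply_eq_of_star_mul_self_eq [CompleteSpace H]
    {A P : H →L[ℂ] H} (h : star A * A = star P * P) (x : H) : ‖A x‖ = ‖P x‖ := by
  have key := congrArg (fun T : H →L[ℂ] H => RCLike.re (inner ℂ (T x) x)) h
  simp only [star_eq_adjoint, mul_def] at key
  rw [← apply_norm_sq_eq_inner_adjoint_left, ← apply_norm_sq_eq_inner_adjoint_left] at key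
  exact (sq_eq_sq₀ (norm_nonneg _) (norm_nonneg _)).mp key

end PolarDecomposition

theorem polar_decomposition_selfAdjoint_injective
    {H : Type*} [NormedAddCommGroup H] [InnerProductSpace ℂ H] [CompleteSpace H]
    (A : H →L[ℂ] H)
    (hA : IsSelfAdjoint A)
    (hinj : Function.Injective A) :
    ∃ J : H →L[ℂ] H,
      IsSelfAdjoint J ∧
      J ∘L J = 1 ∧
      A = J ∘L CFC.sqrt (A * A) ∧
      J ∘L CFC.sqrt (A * A) = CFC.sqrt (A * A) ∘L J := by
  have habs : CFC.sqrt (A * A) = CFC.abs A := by rw [CFC.abs, hA.star_eq]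
  have hPsa : IsSelfAdjoint (CFC.sqrt (A * A)) := IsSelfAdjoint.of_nonneg (CFC.sqrt_nonneg _)
  have hPP : CFC.sqrt (A * A) * CFC.sqrt (A * A) = A * A := by
    rw [habs, CFC.abs_mul_abs, hA.star_eq]
  have hcomm : CFC.sqrt (A * A) * A = A * CFC.sqrt (A * A) := by
    rw [habs]
    exact (CFC.commute_abs_self A hA.isStarNormal).eq
  generalize CFC.sqrt (A * A) = P at hPsa hPP hcomm
  have hnorm : ∀ x, ‖A x‖ = ‖P x‖ :=
    norm_apply_eq_of_star_mul_self_eq (by rw [hA.star_eq, hPsa.star_eq, hPP])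
  have hPinj : Function.Injective P := (injective_iff_map_eq_zero P).mpr fun x hx =>
    (injective_iff_map_eq_zero A).mp hinj x (by rw [← norm_eq_zero, hnorm, hx, norm_zero])
  have hdense := hPsa.denseRange_of_injective hPinj
  obtain ⟨J, hJP⟩ : ∃ J : H →L[ℂ] H, J * P = A :=
    ⟨A.toLinearMap.extendOfNorm P.toLinearMap, ContinuousLinearMap.ext fun x =>
      LinearMap.extendOfNorm_eq (f := A.toLinearMap) (e := P.toLinearMap) hdense
        ⟨1, fun y => by simpa using (hnorm y).le⟩ x⟩
  have hJcomm : J * P = P * J := mul_right_cancel_of_denseRange hdense <| by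
    rw [mul_assoc P, hJP, hcomm]
  have hJA : J * A = P := mul_right_cancel_of_denseRange hdense <| by
    rw [mul_assoc, ← hcomm, ← mul_assoc, hJP, hPP]
  have hJJ : J * J = 1 := mul_right_cancel_of_denseRange hdense <| by
    rw [mul_assoc, hJP, hJA, one_mul]
  have hJsa : IsSelfAdjoint J := by
    have h : star J * P = J * P := by
      rw [hJP, ← hA.star_eq, ← hJP, hJcomm, star_mul, hPsa.star_eq]
    exact mul_right_cancel_of_denseRange hdense h
  exact ⟨J, hJsa, hJJ, hJP.symm, hJcomm⟩
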